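/- For every integer n ≥ 1, ∑_{a+b+c = n, c ≤ 1, a ≥ b ≥ c ≥ 0, a ≥ 1, b ≥ 1} (a - b + 1) · f(a,b,c) computed with f ≡ 1 (i.e. the sum of the coefficients (a-b+1) over all partitions (a,b,c) of n with a ≥ b ≥ 1 and c ∈ {0,1}) equals the number of pairs (l, standard data) counted as ∑_{l=1}^{n-1} dim([(l,1)] ⊗ [(n-l-1)])↑^{S_n} / dim factor; concretely: ∑_{λ=(a,b,c) ⊢ n, c≤1, b≥1} (a-b+1) · d_λ = (n-1) · 2^{n-2}, where d_λ is the number of standard Young tableaux of shape λ. -/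

import Mathlib

/-- Length of the `i`-th row of the Young diagram of the partition `(a, b, c)`. -/
def rowLen15 (a b c i : ℕ) : ℕ := if i = 0 then a else if i = 1 then b else if i = 2 then c else 0

/-- Cells of the Young diagram of `(a, b, c)`. -/
def cells15 (a b c : ℕ) : Set (ℕ × ℕ) := {p | p.2 < rowLen15 a b c p.1}

/-- `f` is a standard Young tableau of shape `(a, b, c)` with entries `0, …, n-1`
(normalized to vanish off the diagram): a bijection from the cells onto `{0,…,n-1}`,
strictly increasing along rows and columns. -/
def IsSYT15 (a b c n : ℕ) (f : ℕ × ℕ → ℕ) : Prop :=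
  Set.BijOn f (cells15 a b c) (Set.Iio n) ∧
  (∀ p : ℕ × ℕ, p ∉ cells15 a b c → f p = 0) ∧
  (∀ i j : ℕ, (i, j + 1) ∈ cells15 a b c → f (i, j) < f (i, j + 1)) ∧
  (∀ i j : ℕ, (i + 1, j) ∈ cells15 a b c → f (i, j) < f (i + 1, j))

/-- `d_{(a,b,c)}`: the number of standard Young tableaux of shape `(a, b, c)` (with `n = a+b+c`). -/
noncomputable def syt15 (a b c n : ℕ) : ℕ := Nat.card {f : ℕ × ℕ → ℕ // IsSYT15 a b c n f}

def syt15G (C : Set (ℕ × ℕ)) (n : ℕ) : Set (ℕ × ℕ → ℕ) :=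
  {f | Set.BijOn f C (Set.Iio n) ∧
  (∀ p : ℕ × ℕ, p ∉ C → f p = 0) ∧
  (∀ i j : ℕ, (i, j + 1) ∈ C → f (i, j) < f (i, j + 1)) ∧
  (∀ i j : ℕ, (i + 1, j) ∈ C → f (i, j) < f (i + 1, j))}

theorem syt15_eq (a b c n : ℕ) : syt15 a b c n = (syt15G (cells15 a b c) n).ncard := rfl

theorem syt15G_finite (C : Set (ℕ × ℕ)) (hC : C.Finite) (n : ℕ) : (syt15G C n).Finite := by
  have : Finite C := hC
  have : Finite (syt15G C n) := by
    apply Finite.of_injective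
      (fun f : syt15G C n => fun c : C => (⟨f.1 c.1, f.2.1.mapsTo c.2⟩ : Fin n))
    intro f g h
    apply Subtype.ext
    funext p
    by_cases hp : p ∈ C
    · have := congrFun h ⟨p, hp⟩
      exact congrArg Fin.val this
    · rw [f.2.2.1 p hp, g.2.2.1 p hp]
  exact this

theorem cells15_finite (a b c : ℕ) : (cells15 a b c).Finite := by
  apply (Set.finite_Iio ((3, a + b + c) : ℕ × ℕ) |>.subset _ : Set.Finite _)
  rintro ⟨i, j⟩ h
  simp only [cells15, rowLen15, Set.mem_ofPred_eq] at h
  simp only [Set.mem_Iio, Prod.lt_iff]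
  split_ifs at h <;> omega

theorem step15 (C : Set (ℕ × ℕ)) (p : ℕ × ℕ) (n : ℕ) (hp : p ∉ C)
    (hr : (p.1, p.2 + 1) ∉ C) (hd : (p.1 + 1, p.2) ∉ C)
    (hl : ∀ j, p.2 = j + 1 → (p.1, j) ∈ C) (hu : ∀ i, p.1 = i + 1 → (i, p.2) ∈ C) :
    {f | f ∈ syt15G (insert p C) (n + 1) ∧ f p = n}.ncard = (syt15G C n).ncard := by
  apply Set.ncard_congr (fun f _ => Function.update f p 0)
  · rintro f ⟨⟨h1, h2, h3, h4⟩, h5⟩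
    have ne : ∀ q ∈ C, q ≠ p := fun q hq h => hp (h ▸ hq)
    refine ⟨⟨?_, ?_, ?_⟩, ?_, ?_, ?_⟩
    · intro q hq
      have h6 := h1.mapsTo (Set.mem_insert_of_mem p hq)
      have h7 : f q ≠ n := fun h => ne q hq
        (h1.injOn (Set.mem_insert_of_mem p hq) (Set.mem_insert p C) (h.trans h5.symm))
      simp only [Set.mem_Iio, Function.update_of_ne (ne q hq)] at h6 ⊢
      omega
    · intro q hq r hr h
      simp only [Function.update_of_ne (ne q hq), Function.update_of_ne (ne r hr)] at h
      exact h1.injOn (Set.mem_insert_of_mem p hq) (Set.mem_insert_of_mem p hr) h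
    · intro m hm
      simp only [Set.mem_Iio] at hm
      obtain ⟨q, hq, rfl⟩ := h1.surjOn (show m ∈ Set.Iio (n + 1) by simp; omega)
      rcases hq with rfl | hq
      · omega
      · exact ⟨q, hq, Function.update_of_ne (ne q hq) _ _⟩
    · intro q hq
      by_cases h : q = p
      · simp [h]
      · rw [Function.update_of_ne h]
        exact h2 q (by simp [h, hq])
    · intro i j h
      have : (i, j) ≠ p := by rintro rfl; exact hr h
      rw [Function.update_of_ne (ne _ h), Function.update_of_ne this]
      exact h3 i j (Set.mem_insert_of_mem p h)
    · intro i j h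
      have : (i, j) ≠ p := by rintro rfl; exact hd h
      rw [Function.update_of_ne (ne _ h), Function.update_of_ne this]
      exact h4 i j (Set.mem_insert_of_mem p h)
  · rintro f g ⟨_, hf⟩ ⟨_, hg⟩ h
    funext q
    by_cases hq : q = p
    · rw [hq, hf, hg]
    · have := congrFun h q
      simpa [Function.update_of_ne hq] using this
  · rintro g ⟨h1, h2, h3, h4⟩
    have ne : ∀ q ∈ C, q ≠ p := fun q hq h => hp (h ▸ hq)
    have lt : ∀ q ∈ C, g q < n := fun q hq => h1.mapsTo hq
    refine ⟨Function.update g p n, ⟨⟨⟨?_, ?_, ?_⟩, ?_, ?_, ?_⟩, by simp⟩, ?_⟩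
    · rintro q (rfl | hq)
      · simp
      · have := lt q hq
        simp only [Set.mem_Iio, Function.update_of_ne (ne q hq)]
        omega
    · rintro q (rfl | hq) r (rfl | hr) h
      · rfl
      · have := lt r hr
        simp [Function.update_of_ne (ne r hr)] at h
        omega
      · have := lt q hq
        simp [Function.update_of_ne (ne q hq)] at h
        omega
      · simp only [Function.update_of_ne (ne q hq), Function.update_of_ne (ne r hr)] at h
        exact h1.injOn hq hr h
    · intro m hm
      simp only [Set.mem_Iio] at hm
      by_cases hmn : m = n
      · exact ⟨p, Set.mem_insert p C, by simp [hmn]⟩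
      · obtain ⟨q, hq, rfl⟩ := h1.surjOn (show m ∈ Set.Iio n by simp; omega)
        exact ⟨q, Set.mem_insert_of_mem p hq, Function.update_of_ne (ne q hq) _ _⟩
    · intro q hq
      simp only [Set.mem_insert_iff, not_or] at hq
      rw [Function.update_of_ne hq.1]
      exact h2 q hq.2
    · rintro i j (h | h)
      · subst h
        have := hl j rfl
        rw [Function.update_of_ne (ne _ this), Function.update_self]
        exact lt _ this
      · have : (i, j) ≠ p := by rintro rfl; exact hr h
        rw [Function.update_of_ne (ne _ h), Function.update_of_ne this]
        exact h3 i j h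
    · rintro i j (h | h)
      · subst h
        have := hu i rfl
        rw [Function.update_of_ne (ne _ this), Function.update_self]
        exact lt _ this
      · have : (i, j) ≠ p := by rintro rfl; exact hd h
        rw [Function.update_of_ne (ne _ h), Function.update_of_ne this]
        exact h4 i j h
    · funext q
      by_cases hq : q = p
      · rw [hq, h2 p hp]; simp
      · simp [Function.update_of_ne hq]

/-- tableaux whose largest entry sits at the end of row `i` -/
def corner15 (a b c n i : ℕ) : Set (ℕ × ℕ → ℕ) :=
  {f | f ∈ syt15G (cells15 a b c) (n + 1) ∧ ∃ j, rowLen15 a b c i = j + 1 ∧ f (i, j) = n}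

theorem corner15_card (a b c a' b' c' n i j : ℕ) (hi : rowLen15 a b c i = j + 1)
    (hrow : ∀ k, rowLen15 a' b' c' k = if k = i then j else rowLen15 a b c k)
    (hlow : rowLen15 a b c (i + 1) ≤ j) (hup : ∀ k, i = k + 1 → j < rowLen15 a b c k) :
    (corner15 a b c n i).ncard = syt15 a' b' c' n := by
  rw [syt15_eq, ← step15 (cells15 a' b' c') (i, j) n]
  · congr 1
    have : cells15 a b c = insert (i, j) (cells15 a' b' c') := by
      ext ⟨x, y⟩
      simp only [cells15, Set.mem_ofPred_eq, Set.mem_insert_iff, hrow, Prod.mk.injEq]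
      by_cases hx : x = i
      · subst hx; simp [hi]; omega
      · simp [hx]
    rw [← this]
    ext f
    simp [corner15, hi]
  · simp [cells15, hrow]
  · simp [cells15, hrow]
  · simp [cells15, hrow]; omega
  · rintro y h
    simp only at h
    simp [cells15, hrow]; omega
  · rintro x h
    simp only at h
    have := hup x h
    have hx : x ≠ i := by omega
    simp [cells15, hrow, hx]; omega

theorem corner15_empty (a b c n i : ℕ) (h : rowLen15 a b c i ≤ rowLen15 a b c (i + 1)) :
    (corner15 a b c n i).ncard = 0 := by
  have : corner15 a b c n i = ∅ := by
    ext f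
    simp only [Set.mem_empty_iff_false, iff_false]
    rintro ⟨⟨h1, h2, h3, h4⟩, j, hj, hf⟩
    have hm : (i + 1, j) ∈ cells15 a b c := by simp [cells15]; omega
    have h5 := h4 i j hm
    have h6 := h1.mapsTo hm
    simp at h6
    omega
  simp [this]

theorem syt15_split (a b c n : ℕ) :
    syt15 a b c (n + 1) = (corner15 a b c n 0).ncard + (corner15 a b c n 1).ncard
      + (corner15 a b c n 2).ncard := by
  have fin := syt15G_finite _ (cells15_finite a b c) (n + 1)
  have finc : ∀ i, (corner15 a b c n i).Finite := fun i => fin.subset (fun f hf => hf.1)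
  have disj : ∀ i k, i ≠ k → Disjoint (corner15 a b c n i) (corner15 a b c n k) := by
    intro i k hik
    rw [Set.disjoint_left]
    rintro f ⟨hf, j, hj, hfj⟩ ⟨_, l, hl, hfl⟩
    have := hf.1.injOn (show (i, j) ∈ cells15 a b c by simp [cells15, hj])
      (show (k, l) ∈ cells15 a b c by simp [cells15, hl]) (hfj.trans hfl.symm)
    simp at this
    exact hik this.1
  rw [← Set.ncard_union_eq (disj 0 1 (by decide)) (finc 0) (finc 1),
    ← Set.ncard_union_eq _ ((finc 0).union (finc 1)) (finc 2), syt15_eq]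
  · congr 1
    ext f
    constructor
    · intro hf
      obtain ⟨⟨i, j⟩, hm, hfn⟩ := hf.1.surjOn (show n ∈ Set.Iio (n + 1) by simp)
      have hj : rowLen15 a b c i = j + 1 := by
        by_contra hne
        have hm' : (i, j + 1) ∈ cells15 a b c := by
          simp [cells15] at hm ⊢; omega
        have h5 := hf.2.2.1 i j hm'
        have h6 := hf.1.mapsTo hm'
        simp at h6
        omega
      have hi : i = 0 ∨ i = 1 ∨ i = 2 := by
        simp only [rowLen15] at hj
        split_ifs at hj <;> omega
      have : f ∈ corner15 a b c n i := ⟨hf, j, hj, hfn⟩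
      rcases hi with rfl | rfl | rfl
      · exact Or.inl (Or.inl this)
      · exact Or.inl (Or.inr this)
      · exact Or.inr this
    · rintro ((h | h) | h) <;> exact h.1
  · rw [Set.disjoint_union_left]
    exact ⟨disj 0 2 (by decide), disj 1 2 (by decide)⟩

theorem branch15 (a b c n : ℕ) (h1 : b ≤ a) (h2 : c ≤ b) :
    syt15 a b c (n + 1) = (if b < a then syt15 (a - 1) b c n else 0)
      + (if c < b then syt15 a (b - 1) c n else 0) + (if 0 < c then syt15 a b (c - 1) n else 0) := by
  rw [syt15_split]
  congr 1
  · congr 1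
    · split_ifs with h
      · apply corner15_card (j := a - 1)
        · simp [rowLen15]; omega
        · intro k; simp only [rowLen15]; split_ifs <;> omega
        · simp [rowLen15]; omega
        · intro k hk; omega
      · apply corner15_empty; simp [rowLen15]; omega
    · split_ifs with h
      · apply corner15_card (j := b - 1)
        · simp [rowLen15]; omega
        · intro k; simp only [rowLen15]; split_ifs <;> omega
        · simp [rowLen15]; omega
        · intro k hk
          obtain rfl : k = 0 := by omega
          simp [rowLen15]; omega
      · apply corner15_empty; simp [rowLen15]; omega
  · split_ifs with h
    · apply corner15_card (j := c - 1)
      · simp [rowLen15]; omega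
      · intro k; simp only [rowLen15]; split_ifs <;> omega
      · simp [rowLen15]
      · intro k hk
        obtain rfl : k = 1 := by omega
        simp [rowLen15]; omega
    · apply corner15_empty; simp [rowLen15]; omega

theorem syt15_zero : syt15 0 0 0 0 = 1 := by
  rw [syt15_eq, Set.ncard_eq_one]
  have hc : cells15 0 0 0 = ∅ := by
    ext p; simp [cells15, rowLen15]
  refine ⟨fun _ => 0, ?_⟩
  ext f
  rw [hc]
  simp only [syt15G, Set.mem_ofPred_eq, Set.mem_singleton_iff]
  constructor
  · rintro ⟨_, h, _⟩
    funext p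
    exact h p (by simp)
  · rintro rfl
    refine ⟨⟨?_, ?_, ?_⟩, ?_, ?_, ?_⟩ <;> simp [Set.MapsTo, Set.SurjOn]

noncomputable def D0 (n b : ℕ) : ℤ := if 2 * b ≤ n then syt15 (n - b) b 0 n else 0
noncomputable def D1 (n b : ℕ) : ℤ :=
  if 1 ≤ b ∧ 2 * b + 1 ≤ n then syt15 (n - 1 - b) b 1 n else 0

theorem D0_zero (n : ℕ) : D0 n 0 = 1 := by
  induction n with
  | zero => simp [D0, syt15_zero]
  | succ n ih =>
    simp [D0] at ih ⊢
    rw [branch15 _ _ _ _ (by omega) (by omega)]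
    simp [ih]

theorem D0_succ (n b : ℕ) :
    ((n : ℤ) - 2 * b) * D0 (n + 1) (b + 1) = ((n : ℤ) - 2 * b) * (D0 n (b + 1) + D0 n b) := by
  rcases lt_trichotomy n (2 * b) with h | h | h
  · simp only [D0]
    rw [if_neg (by omega), if_neg (by omega), if_neg (by omega)]; simp
  · have : (n : ℤ) - 2 * b = 0 := by omega
    simp [this]
  · congr 1
    simp only [D0]
    rw [if_pos (by omega), branch15 _ _ _ _ (by omega) (by omega), if_pos (by omega : 2 * b ≤ n)]
    have e1 : n + 1 - (b + 1) - 1 = n - (b + 1) := by omega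
    have e2 : n + 1 - (b + 1) = n - b := by omega
    rw [e1, e2]
    by_cases h' : 2 * (b + 1) ≤ n
    · rw [if_pos h', if_pos (by omega)]; simp
    · rw [if_neg h', if_neg (by omega)]; simp

theorem D1_succ (n b : ℕ) :
    ((n : ℤ) - 1 - 2 * b) * D1 (n + 1) (b + 1) =
      ((n : ℤ) - 1 - 2 * b) * (D1 n (b + 1) + D1 n b + D0 n (b + 1)) := by
  rcases lt_trichotomy n (2 * b + 1) with h | h | h
  · simp only [D0, D1]
    rw [if_neg (by omega), if_neg (by omega), if_neg (by omega), if_neg (by omega)]; simp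
  · have : (n : ℤ) - 1 - 2 * b = 0 := by omega
    simp [this]
  · congr 1
    simp only [D0, D1]
    rw [if_pos (by omega), branch15 _ _ _ _ (by omega) (by omega),
      if_pos (by omega : 2 * (b + 1) ≤ n)]
    have e1 : n + 1 - 1 - (b + 1) - 1 = n - 1 - (b + 1) := by omega
    have e2 : n + 1 - 1 - (b + 1) = n - (b + 1) := by omega
    have e3 : n - 1 - b = n - (b + 1) := by omega
    rw [e1, e2, e3]
    have c1 : (1 ≤ b + 1 ∧ 2 * (b + 1) + 1 ≤ n) ↔ b + 1 < n - (b + 1) := by omega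
    have c2 : (1 ≤ b ∧ 2 * b + 1 ≤ n) ↔ 1 < b + 1 := by omega
    simp only [c1, c2]
    push_cast
    simp

noncomputable def T0 (n : ℕ) : ℤ := ∑ b ∈ Finset.range (n + 1), ((n : ℤ) - 2 * b + 1) * D0 n b
noncomputable def T1 (n : ℕ) : ℤ := ∑ b ∈ Finset.range (n + 1), ((n : ℤ) - 2 * b) * D1 n b

theorem D0_big (n b : ℕ) (h : n < 2 * b) : D0 n b = 0 := by simp [D0]; omega
theorem D1_big (n b : ℕ) (h : n < 2 * b) : D1 n b = 0 := by simp [D1]; omega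
theorem D1_zero (n : ℕ) : D1 n 0 = 0 := by simp [D1]

theorem T0_succ (n : ℕ) : T0 (n + 1) = 2 * T0 n := by
  have key : T0 (n + 1) = (n + 2) * D0 n 0 +
      (∑ b ∈ Finset.range (n + 1), ((n : ℤ) - 2 * b) * D0 n (b + 1) +
      ∑ b ∈ Finset.range (n + 1), ((n : ℤ) - 2 * b) * D0 n b) := by
    rw [T0, Finset.sum_range_succ', ← Finset.sum_add_distrib, add_comm]
    congr 1
    · simp only [D0_zero]; push_cast; ring
    · apply Finset.sum_congr rfl
      intro b _
      have := D0_succ n b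
      push_cast
      linear_combination this
  have h2 : (n + 2) * D0 n 0 + ∑ b ∈ Finset.range (n + 1), ((n : ℤ) - 2 * b) * D0 n (b + 1)
      = ∑ b ∈ Finset.range (n + 1), ((n : ℤ) - 2 * b + 2) * D0 n b := by
    rw [Finset.sum_range_succ, D0_big n (n + 1) (by omega), Finset.sum_range_succ' _ n, add_comm]
    simp only [mul_zero, add_zero]
    congr 1
    · apply Finset.sum_congr rfl
      intro b _; push_cast; ring
  rw [key, ← add_assoc, h2, ← Finset.sum_add_distrib, T0, Finset.mul_sum]
  apply Finset.sum_congr rfl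
  intro b _; ring

theorem T1_succ (n : ℕ) : T1 (n + 1) = 2 * T1 n + T0 n - (n + 1) := by
  have key : T1 (n + 1) = 
      ∑ b ∈ Finset.range (n + 1), ((n : ℤ) - 1 - 2 * b) * D1 n (b + 1) +
      ∑ b ∈ Finset.range (n + 1), ((n : ℤ) - 1 - 2 * b) * D1 n b +
      ∑ b ∈ Finset.range (n + 1), ((n : ℤ) - 1 - 2 * b) * D0 n (b + 1) := by
    rw [T1, Finset.sum_range_succ', ← Finset.sum_add_distrib, ← Finset.sum_add_distrib, D1_zero,
      mul_zero, add_zero]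
    apply Finset.sum_congr rfl
    intro b _
    have := D1_succ n b
    push_cast
    linear_combination this
  have h2 : ∑ b ∈ Finset.range (n + 1), ((n : ℤ) - 1 - 2 * b) * D1 n (b + 1)
      = ∑ b ∈ Finset.range (n + 1), ((n : ℤ) - 2 * b + 1) * D1 n b := by
    rw [Finset.sum_range_succ, D1_big n (n + 1) (by omega), Finset.sum_range_succ' _ n, D1_zero]
    simp only [mul_zero, add_zero]
    apply Finset.sum_congr rfl
    intro b _; push_cast; ring
  have h3 : ∑ b ∈ Finset.range (n + 1), ((n : ℤ) - 1 - 2 * b) * D0 n (b + 1) = T0 n - (n + 1) := by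
    rw [T0, Finset.sum_range_succ, D0_big n (n + 1) (by omega), Finset.sum_range_succ' _ n, D0_zero]
    simp only [mul_zero, add_zero, mul_one, Nat.cast_zero, sub_zero, add_sub_cancel_right]
    apply Finset.sum_congr rfl
    intro b _; push_cast; ring
  rw [key, h2, h3, ← Finset.sum_add_distrib, T1, Finset.mul_sum, add_sub_assoc]
  congr 1
  apply Finset.sum_congr rfl
  intro b _; ring

theorem T0_eq (n : ℕ) : T0 n = 2 ^ n := by
  induction n with
  | zero => simp [T0, D0_zero]
  | succ n ih => rw [T0_succ, ih]; ring

theorem T1_eq (n : ℕ) : 2 * T1 n = n * 2 ^ n - 4 * 2 ^ n + 2 * n + 4 := by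
  induction n with
  | zero => simp [T1, D1_zero]
  | succ n ih => rw [T1_succ, T0_eq]; push_cast; linear_combination 2 * ih

theorem lhs15 (n : ℕ) (hn : 1 ≤ n) :
    2 * ((∑ l ∈ Finset.Icc 1 (n - 1), Nat.choose n (l + 1) * l : ℕ) : ℤ) =
      n * 2 ^ n - 2 * 2 ^ n + 2 := by
  obtain ⟨m, rfl⟩ : ∃ m, n = m + 1 := ⟨n - 1, by omega⟩
  have h1 : (∑ k ∈ Finset.range (m + 2), (((m + 1).choose k : ℕ) : ℤ)) = 2 ^ (m + 1) := by
    exact_mod_cast Nat.sum_range_choose (m + 1)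
  have h2 : (∑ k ∈ Finset.range (m + 2), ((k : ℤ) * ((m + 1).choose k : ℕ))) = (m + 1) * 2 ^ m := by
    have := Nat.sum_range_mul_choose (m + 1)
    simp at this
    exact_mod_cast this
  have h3 : ∑ k ∈ Finset.range (m + 2), ((k : ℤ) - 1) * ((m + 1).choose k : ℕ)
      = (m + 1) * 2 ^ m - 2 ^ (m + 1) := by
    rw [← h1, ← h2, ← Finset.sum_sub_distrib]
    apply Finset.sum_congr rfl
    intro k _; ring
  rw [Finset.sum_range_succ', Finset.sum_range_succ'] at h3
  have h4 : Finset.Icc 1 (m + 1 - 1) = Finset.Ico 1 (m + 1) := by ext; simp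
  rw [h4, Finset.sum_Ico_eq_sum_range]
  push_cast at h3 ⊢
  have h5 : ∑ k ∈ Finset.range m, (((m + 1).choose (1 + k + 1) : ℕ) : ℤ) * (1 + (k : ℤ)) =
    ∑ k ∈ Finset.range m, ((k : ℤ) + 1 + 1 - 1) * ((m + 1).choose (k + 1 + 1) : ℕ) := by
    apply Finset.sum_congr rfl
    intro k _
    rw [add_comm 1 k]; ring
  rw [h5]
  simp at h3 ⊢
  linear_combination 2 * h3

theorem rhs15 (n : ℕ) :
    ((∑ x ∈ (Finset.range (n + 1) ×ˢ Finset.range (n + 1) ×ˢ Finset.range 2).filter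
          (fun x => x.1 + x.2.1 + x.2.2 = n ∧ x.2.1 ≤ x.1 ∧ x.2.2 ≤ x.2.1 ∧ 1 ≤ x.2.1),
        (x.1 - x.2.1 + 1) * syt15 x.1 x.2.1 x.2.2 n : ℕ) : ℤ) = T0 n + T1 n - (n + 1) := by
  have h0 : T0 n - (n + 1) = ∑ b ∈ Finset.range (n + 1),
      if b = 0 then 0 else ((n : ℤ) - 2 * b + 1) * D0 n b := by
    rw [T0, Finset.sum_range_succ', Finset.sum_range_succ', D0_zero]
    simp
  have h1 : T0 n + T1 n - (n + 1) = (T0 n - (n + 1)) + T1 n := by ring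
  rw [h1, h0, T1, ← Finset.sum_add_distrib, Finset.sum_filter, Finset.sum_product,
    Finset.sum_comm' (s' := fun _ => Finset.range (n + 1)) (t' := Finset.range (n+1) ×ˢ Finset.range 2)
      (by intros; tauto), Finset.sum_product]
  push_cast
  apply Finset.sum_congr rfl
  intro b hb
  rw [Finset.sum_range_succ, Finset.sum_range_one]
  congr 1
  · rw [Finset.sum_eq_single (n - b)]
    · simp only [D0]
      by_cases h : 1 ≤ b ∧ 2 * b ≤ n
      · rw [if_pos (by omega), if_neg (by omega), if_pos (by omega)]
        have : ((n - b - b : ℕ) : ℤ) = n - 2 * b := by omega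
        push_cast [this]; rfl
      · rw [if_neg (by omega)]
        split_ifs <;> first | omega | simp
    · intro a _ ha
      rw [if_neg (by omega)]
    · intro h; simp at h
  · rw [Finset.sum_eq_single (n - 1 - b)]
    · simp only [D1]
      by_cases h : 1 ≤ b ∧ 2 * b + 1 ≤ n
      · rw [if_pos (by omega), if_pos (by omega)]
        have : ((n - 1 - b - b : ℕ) : ℤ) = n - 1 - 2 * b := by omega
        push_cast [this]; ring
      · rw [if_neg (by omega), if_neg (by omega)]; simp
    · intro a _ ha
      rw [if_neg (by omega)]
    · intro h; simp at h; omega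

/-- Dimension identity for Lemma 4.1:
`∑_{l=1}^{n-1} C(n, l+1)·l = ∑_{(a,b,c) ⊢ n, a ≥ b ≥ c, c ≤ 1, b ≥ 1} (a-b+1)·d_{(a,b,c)}`. -/
theorem stmt15 (n : ℕ) (hn : 1 ≤ n) :
    ∑ l ∈ Finset.Icc 1 (n - 1), Nat.choose n (l + 1) * l =
      ∑ x ∈ (Finset.range (n + 1) ×ˢ Finset.range (n + 1) ×ˢ Finset.range 2).filter
          (fun x => x.1 + x.2.1 + x.2.2 = n ∧ x.2.1 ≤ x.1 ∧ x.2.2 ≤ x.2.1 ∧ 1 ≤ x.2.1),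
        (x.1 - x.2.1 + 1) * syt15 x.1 x.2.1 x.2.2 n := by
  have h1 := lhs15 n hn
  have h2 := rhs15 n
  have h3 := T1_eq n
  rw [T0_eq] at h2
  zify at h1 h2 ⊢
  linarith
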